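/- arXiv:math/0310323 — 3 statements merged into one kernel-verified Lean document; each statement's English description precedes it below -/
import Mathlib

section
/- There is a universal constant C > 0 such that the constants B_{n,k} = (1/(k! n^{k/2})) Σ_{s=1}^{k} (−1)^{k−s} binom(n,s) s! Σ_{(r_1,…,r_s): r_j ≥ 1, r_1+⋯+r_s = k} (r_1−1)⋯(r_s−1) B(r_1,…,r_s) satisfy |B_{n,k}| ≤ C^k / k^{k/2} for all integers k ≥ 1 and all n ≥ k/2. -/
open scoped Classical

noncomputable section

namespace EmpInt

/-- `B(r_1,…,r_s)`: the number of partitions of `{1,…,k}` into disjoint sets of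
cardinalities `r_1,…,r_s`. -/
def numPart (k s : ℕ) (r : Fin s → ℕ) : ℕ :=
  (Finset.univ.filter fun P : Finset (Finset (Fin k)) =>
      (∀ A ∈ P, ∀ B ∈ P, A ≠ B → Disjoint A B) ∧
      P.sup id = Finset.univ ∧
      Multiset.map Finset.card P.val = ↑(List.ofFn r)).card

/-- The constant `B_{n,k}` of Lemma 1, formula (3.9). -/
def Bconst (n k : ℕ) : ℝ :=
  ((Nat.factorial k : ℝ) * (n : ℝ) ^ ((k : ℝ) / 2))⁻¹ *
    ∑ s ∈ Finset.Icc 1 k, (-1 : ℝ) ^ (k - s) * (n.choose s : ℝ) * (Nat.factorial s : ℝ) *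
      ∑ r ∈ (Finset.Nat.antidiagonalTuple s k).filter fun r => ∀ j, 1 ≤ r j,
        (∏ j, ((r j : ℝ) - 1)) * (numPart k s r : ℝ)

end EmpInt

namespace EmpInt

/-- The cyclic permutation of the elements of `A` following an arbitrary enumeration of `A`. -/
def cycleOn {α : Type*} [DecidableEq α] (A : Finset α) : Equiv.Perm α := A.toList.formPerm

lemma isCycle_cycleOn {α : Type*} [DecidableEq α] {A : Finset α} (hA : 2 ≤ A.card) :
    (cycleOn A).IsCycle :=
  List.isCycle_formPerm A.nodup_toList (by simpa using hA)

lemma support_cycleOn {α : Type*} [Fintype α] [DecidableEq α] {A : Finset α} (hA : 2 ≤ A.card) :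
    (cycleOn A).support = A := by
  unfold cycleOn
  rw [List.support_formPerm_of_nodup _ A.nodup_toList, Finset.toList_toFinset]
  intro x hx
  have := congrArg List.length hx
  simp at this
  omega

/-- A family of pairwise disjoint sets of size at least two is the family of supports of the
cycles of some permutation. -/
lemma exists_perm_supports {α : Type*} [Fintype α] [DecidableEq α] (P : Finset (Finset α))
    (hd : ∀ A ∈ P, ∀ B ∈ P, A ≠ B → Disjoint A B) (h2 : ∀ A ∈ P, 2 ≤ A.card) :
    ∃ σ : Equiv.Perm α, σ.cycleType = P.val.map Finset.card ∧
      σ.cycleFactorsFinset.image Equiv.Perm.support = P := by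
  have hinj : Set.InjOn cycleOn (P : Set (Finset α)) := by
    intro A hA B hB h
    rw [← support_cycleOn (h2 A hA), h, support_cycleOn (h2 B hB)]
  have hcyc : ∀ f ∈ P.image cycleOn, f.IsCycle := by
    intro f hf
    obtain ⟨A, hA, rfl⟩ := Finset.mem_image.1 hf
    exact isCycle_cycleOn (h2 A hA)
  have hpw : ((P.image cycleOn : Finset (Equiv.Perm α)) : Set (Equiv.Perm α)).Pairwise
      Equiv.Perm.Disjoint := by
    intro f hf g hg hfg
    obtain ⟨A, hA, rfl⟩ := Finset.mem_image.1 hf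
    obtain ⟨B, hB, rfl⟩ := Finset.mem_image.1 hg
    rw [Equiv.Perm.disjoint_iff_disjoint_support, support_cycleOn (h2 A hA),
      support_cycleOn (h2 B hB)]
    exact hd A hA B hB fun h => hfg (h ▸ rfl)
  obtain ⟨σ, hσ⟩ : ∃ σ : Equiv.Perm α, σ.cycleFactorsFinset = P.image cycleOn :=
    ⟨_, Equiv.Perm.cycleFactorsFinset_eq_finset.2 ⟨hcyc, hpw, rfl⟩⟩
  refine ⟨σ, ?_, ?_⟩
  rotate_left
  · rw [hσ, Finset.image_image]
    conv_rhs => rw [← Finset.image_id (s := P)]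
    exact Finset.image_congr fun A hA => support_cycleOn (h2 A hA)
  · rw [Equiv.Perm.cycleType_def, hσ, Finset.image_val_of_injOn hinj, Multiset.map_map]
    exact Multiset.map_congr rfl fun A hA => by
      simp [support_cycleOn (h2 A hA)]

/-- Partitions into blocks of sizes `r` are at most as numerous as permutations of cycle type
`r`. -/
lemma numPart_mul_le {k s : ℕ} (r : Fin s → ℕ) (hr : ∀ j, 2 ≤ r j) (hk : ∑ j, r j = k) :
    numPart k s r * ((∏ j, r j) *
      ∏ i ∈ (↑(List.ofFn r) : Multiset ℕ).toFinset,
        ((↑(List.ofFn r) : Multiset ℕ).count i).factorial) ≤ k.factorial := by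
  set m : Multiset ℕ := ↑(List.ofFn r) with hm
  have hsum : m.sum = k := by simp [hm, List.sum_ofFn, hk]
  have hprod : m.prod = ∏ j, r j := by simp [hm, List.prod_ofFn]
  have hge : ∀ a ∈ m, 2 ≤ a := by
    intro a ha
    obtain ⟨j, rfl⟩ := (List.mem_ofFn' r a).1 (by simpa [hm] using ha)
    exact hr j
  have hcount := Equiv.Perm.card_of_cycleType_mul_eq (Fin k) m
  rw [if_pos ⟨by simp [hsum], hge⟩] at hcount
  simp only [Fintype.card_fin, hsum, hprod, Nat.sub_self, Nat.factorial_zero, one_mul] at hcount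
  rw [← hcount]
  gcongr
  have key : ∀ P : Finset (Finset (Fin k)),
      ((∀ A ∈ P, ∀ B ∈ P, A ≠ B → Disjoint A B) ∧ P.sup id = Finset.univ ∧
        Multiset.map Finset.card P.val = m) →
      ∃ σ : Equiv.Perm (Fin k), σ.cycleType = m ∧
        σ.cycleFactorsFinset.image Equiv.Perm.support = P := by
    rintro P ⟨hd, -, hc⟩
    obtain ⟨σ, h, h'⟩ := exists_perm_supports P hd fun A hA =>
      hge _ (hc ▸ Multiset.mem_map_of_mem _ hA)
    exact ⟨σ, h.trans hc, h'⟩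
  unfold numPart
  refine Finset.card_le_card_of_surjOn
    (fun σ : Equiv.Perm (Fin k) => σ.cycleFactorsFinset.image Equiv.Perm.support) ?_
  intro P hP
  obtain ⟨σ, h, h'⟩ := key P (by simpa [hm] using hP)
  exact ⟨σ, by simpa using h, by convert h'⟩

/-- One term of the expansion of `exp (k ∑ 2⁻ⁱ)` is at most the whole. -/
lemma pow_card_le (k : ℕ) (m : Multiset ℕ) (hm : m.sum = k) :
    (k : ℝ) ^ m.card ≤
      (2 * Real.exp 2) ^ k * ∏ i ∈ m.toFinset, ((m.count i).factorial : ℝ) := by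
  have hterm : ∀ i ∈ m.toFinset, (k : ℝ) ^ m.count i ≤
      Real.exp (k * (1 / 2) ^ i) * 2 ^ (m.count i * i) * (m.count i).factorial := by
    intro i _
    have h := Real.pow_div_factorial_le_exp (k * (1 / 2 : ℝ) ^ i) (by positivity) (m.count i)
    rw [div_le_iff₀ (by positivity), mul_pow, ← pow_mul] at h
    calc (k : ℝ) ^ m.count i
        = (k : ℝ) ^ m.count i * (1 / 2) ^ (i * m.count i) * 2 ^ (m.count i * i) := by
          rw [mul_assoc, mul_comm i, ← mul_pow]; norm_num
      _ ≤ (Real.exp (k * (1 / 2) ^ i) * (m.count i).factorial) * 2 ^ (m.count i * i) := by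
          gcongr
      _ = _ := by ring
  have hgeom : ∑ i ∈ m.toFinset, (1 / 2 : ℝ) ^ i ≤ 2 := by
    exact (summable_geometric_two.sum_le_tsum _ fun i _ => by positivity).trans_eq
      tsum_geometric_two
  have hpow : ∑ i ∈ m.toFinset, m.count i * i = k := by
    rw [← hm, Finset.sum_multiset_count]
    simp
  calc (k : ℝ) ^ m.card = ∏ i ∈ m.toFinset, (k : ℝ) ^ m.count i := by
        rw [Finset.prod_pow_eq_pow_sum, Multiset.toFinset_sum_count_eq]
    _ ≤ ∏ i ∈ m.toFinset,
        (Real.exp (k * (1 / 2) ^ i) * 2 ^ (m.count i * i) * (m.count i).factorial) :=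
        Finset.prod_le_prod (fun i _ => by positivity) hterm
    _ = Real.exp (k * ∑ i ∈ m.toFinset, (1 / 2 : ℝ) ^ i) * 2 ^ k *
        ∏ i ∈ m.toFinset, ((m.count i).factorial : ℝ) := by
        rw [Finset.prod_mul_distrib, Finset.prod_mul_distrib, ← Real.exp_sum,
          Finset.prod_pow_eq_pow_sum, hpow, Finset.mul_sum]
    _ ≤ Real.exp (k * 2) * 2 ^ k * ∏ i ∈ m.toFinset, ((m.count i).factorial : ℝ) := by
        gcongr
    _ = _ := by rw [mul_pow, Real.exp_nat_mul]; ring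

lemma card_positive_tuples_le (s k : ℕ) :
    ((Finset.Nat.antidiagonalTuple s k).filter fun r => ∀ j, 1 ≤ r j).card ≤ 2 ^ k := by
  set S := (Finset.Nat.antidiagonalTuple s k).filter fun r => ∀ j, 1 ≤ r j with hS
  have hmem : ∀ r ∈ S, (∀ i ∈ List.ofFn r, 0 < i) ∧ (List.ofFn r).sum = k := by
    intro r hr
    obtain ⟨hsum, hpos⟩ := Finset.mem_filter.1 hr
    refine ⟨fun i hi => ?_, by rw [List.sum_ofFn]; exact Finset.Nat.mem_antidiagonalTuple.1 hsum⟩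
    obtain ⟨j, rfl⟩ := (List.mem_ofFn' r i).1 hi
    exact hpos j
  calc S.card = Fintype.card S := (Fintype.card_coe S).symm
    _ ≤ Fintype.card (Composition k) := by
        refine Fintype.card_le_of_injective (fun r : S =>
          (⟨List.ofFn r.1, fun {i} hi => (hmem r.1 r.2).1 i hi, (hmem r.1 r.2).2⟩ :
            Composition k)) ?_
        intro r r' h
        exact Subtype.ext (List.ofFn_injective (congrArg Composition.blocks h))
    _ = 2 ^ (k - 1) := composition_card k
    _ ≤ 2 ^ k := Nat.pow_le_pow_right (by norm_num) (Nat.sub_le k 1)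

lemma pow_le_of_half_le {n k s : ℕ} (hk : 1 ≤ k) (hn : (k : ℝ) / 2 ≤ n) (hs : 2 * s ≤ k) :
    (n : ℝ) ^ s ≤ (n : ℝ) ^ ((k : ℝ) / 2) * (2 ^ k * (k : ℝ) ^ s / (k : ℝ) ^ ((k : ℝ) / 2)) := by
  have hk0 : (0 : ℝ) < k := by exact_mod_cast hk
  have hn0 : (0 : ℝ) < n := by linarith
  have hs' : (2 : ℝ) * s ≤ k := by exact_mod_cast hs
  have h1 : (n : ℝ) ^ ((s : ℝ) - k / 2) ≤ ((k : ℝ) / 2) ^ ((s : ℝ) - k / 2) :=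
    Real.rpow_le_rpow_of_nonpos (by positivity) hn (by linarith)
  have h2 : ((2 : ℝ) ^ ((s : ℝ) - k / 2))⁻¹ ≤ 2 ^ k := by
    rw [← Real.rpow_neg (by norm_num), ← Real.rpow_natCast 2 k]
    exact Real.rpow_le_rpow_of_exponent_le (by norm_num) (by
      have : (0 : ℝ) ≤ s := by positivity
      linarith)
  calc (n : ℝ) ^ s = (n : ℝ) ^ ((k : ℝ) / 2) * (n : ℝ) ^ ((s : ℝ) - k / 2) := by
        rw [← Real.rpow_add hn0, ← Real.rpow_natCast]; congr 1; ring
    _ ≤ (n : ℝ) ^ ((k : ℝ) / 2) * ((k : ℝ) / 2) ^ ((s : ℝ) - k / 2) := by gcongr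
    _ = (n : ℝ) ^ ((k : ℝ) / 2) * (((2 : ℝ) ^ ((s : ℝ) - k / 2))⁻¹ * (k : ℝ) ^ s /
        (k : ℝ) ^ ((k : ℝ) / 2)) := by
        rw [Real.div_rpow hk0.le (by norm_num), Real.rpow_sub hk0, Real.rpow_natCast]
        ring
    _ ≤ _ := by gcongr

lemma summand_le {n k s : ℕ} (hk : 1 ≤ k) (hn : (k : ℝ) / 2 ≤ n) (r : Fin s → ℕ)
    (hr : ∀ j, 1 ≤ r j) (hsum : ∑ j, r j = k) :
    (n : ℝ) ^ s * ((∏ j, ((r j : ℝ) - 1)) * numPart k s r) ≤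
      k.factorial * (n : ℝ) ^ ((k : ℝ) / 2) *
        ((4 * Real.exp 2) ^ k / (k : ℝ) ^ ((k : ℝ) / 2)) := by
  by_cases h1 : ∃ j, r j = 1
  · obtain ⟨j, hj⟩ := h1
    rw [Finset.prod_eq_zero (Finset.mem_univ j) (by simp [hj])]
    simp only [zero_mul, mul_zero]
    positivity
  have h2 : ∀ j, 2 ≤ r j := fun j => by
    have := hr j
    have : r j ≠ 1 := fun h => h1 ⟨j, h⟩
    omega
  have hs : 2 * s ≤ k := by
    rw [← hsum, mul_comm]
    simpa using Finset.card_nsmul_le_sum Finset.univ r 2 fun j _ => h2 j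
  have hcard := pow_card_le k (↑(List.ofFn r) : Multiset ℕ) (by simp [List.sum_ofFn, hsum])
  simp only [Multiset.coe_card, List.length_ofFn] at hcard
  set M : ℝ := ∏ i ∈ (↑(List.ofFn r) : Multiset ℕ).toFinset,
        (((↑(List.ofFn r) : Multiset ℕ).count i).factorial : ℝ) with hM
  have hpart : (numPart k s r : ℝ) * ((∏ j, (r j : ℝ)) * M) ≤ k.factorial := by
    rw [hM]
    exact_mod_cast numPart_mul_le r h2 hsum
  have hM0 : 0 ≤ M := by positivity
  have hr' : ∀ j, 0 ≤ (r j : ℝ) - 1 := fun j => sub_nonneg.2 (by exact_mod_cast hr j)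
  have hprod : ∏ j, ((r j : ℝ) - 1) ≤ ∏ j, (r j : ℝ) :=
    Finset.prod_le_prod (fun j _ => hr' j) fun j _ => by linarith
  calc (n : ℝ) ^ s * ((∏ j, ((r j : ℝ) - 1)) * numPart k s r)
      ≤ ((n : ℝ) ^ ((k : ℝ) / 2) * (2 ^ k * ((2 * Real.exp 2) ^ k * M) /
          (k : ℝ) ^ ((k : ℝ) / 2))) * ((∏ j, (r j : ℝ)) * numPart k s r) := by
        refine mul_le_mul ((pow_le_of_half_le hk hn hs).trans ?_) ?_
          (mul_nonneg (Finset.prod_nonneg fun j _ => hr' j) (Nat.cast_nonneg _)) (by positivity)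
        · gcongr
        · gcongr
    _ = (n : ℝ) ^ ((k : ℝ) / 2) * ((4 * Real.exp 2) ^ k / (k : ℝ) ^ ((k : ℝ) / 2)) *
          (numPart k s r * ((∏ j, (r j : ℝ)) * M)) := by
        rw [show (4 : ℝ) * Real.exp 2 = 2 * (2 * Real.exp 2) by ring, mul_pow 2 (2 * Real.exp 2)]
        ring
    _ ≤ (n : ℝ) ^ ((k : ℝ) / 2) * ((4 * Real.exp 2) ^ k / (k : ℝ) ^ ((k : ℝ) / 2)) *
          k.factorial := by gcongr
    _ = _ := by ring

lemma choose_mul_factorial_le_pow (n s : ℕ) :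
    (n.choose s : ℝ) * s.factorial ≤ (n : ℝ) ^ s := by
  rw [mul_comm]
  exact_mod_cast (Nat.descFactorial_eq_factorial_mul_choose n s) ▸ Nat.descFactorial_le_pow n s

end EmpInt

/-- Lemma 1, formula (3.10): `|B_{n,k}| ≤ C^k / k^{k/2}` for `n ≥ k/2`, with a universal
constant `C`. -/
theorem lemma1_Bnk_bound :
    ∃ C > (0:ℝ), ∀ k n : ℕ, 1 ≤ k → (k : ℝ) / 2 ≤ (n : ℝ) →
      |EmpInt.Bconst n k| ≤ C ^ k / (k : ℝ) ^ ((k : ℝ) / 2) := by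
  refine ⟨16 * Real.exp 2, by positivity, fun k n hk hn => ?_⟩
  have hk0 : (0 : ℝ) < k := by exact_mod_cast hk
  have hn0 : (0 : ℝ) < n := by linarith
  set D : ℝ := k.factorial * (n : ℝ) ^ ((k : ℝ) / 2) with hD
  have hD0 : 0 < D := by positivity
  set T : ℝ := (4 * Real.exp 2) ^ k / (k : ℝ) ^ ((k : ℝ) / 2) with hT
  have hT0 : 0 ≤ T := by positivity
  have hs : ∀ s ∈ Finset.Icc 1 k,
      |(-1 : ℝ) ^ (k - s) * (n.choose s : ℝ) * (Nat.factorial s : ℝ) *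
        ∑ r ∈ (Finset.Nat.antidiagonalTuple s k).filter fun r => ∀ j, 1 ≤ r j,
          (∏ j, ((r j : ℝ) - 1)) * (EmpInt.numPart k s r : ℝ)| ≤ 2 ^ k * (D * T) := by
    intro s _
    have hnonneg : ∀ r ∈ (Finset.Nat.antidiagonalTuple s k).filter fun r => ∀ j, 1 ≤ r j,
        0 ≤ (∏ j, ((r j : ℝ) - 1)) * (EmpInt.numPart k s r : ℝ) := by
      intro r hr
      refine mul_nonneg (Finset.prod_nonneg fun j _ => ?_) (Nat.cast_nonneg _)
      have : (1 : ℝ) ≤ r j := by exact_mod_cast (Finset.mem_filter.1 hr).2 j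
      linarith
    have hsum0 := Finset.sum_nonneg hnonneg
    rw [abs_mul, abs_mul, abs_mul, abs_pow, abs_neg, abs_one, one_pow, one_mul, Nat.abs_cast,
      Nat.abs_cast, abs_of_nonneg hsum0]
    refine (mul_le_mul_of_nonneg_right (EmpInt.choose_mul_factorial_le_pow n s) hsum0).trans ?_
    rw [Finset.mul_sum]
    refine (Finset.sum_le_card_nsmul _ _ (D * T) fun r hr => ?_).trans ?_
    · obtain ⟨hr, hpos⟩ := Finset.mem_filter.1 hr
      exact EmpInt.summand_le hk hn r hpos (Finset.Nat.mem_antidiagonalTuple.1 hr)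
    · rw [nsmul_eq_mul]
      gcongr
      exact_mod_cast EmpInt.card_positive_tuples_le s k
  unfold EmpInt.Bconst
  rw [abs_mul, abs_of_pos (inv_pos.2 hD0), inv_mul_le_iff₀ hD0]
  refine (Finset.abs_sum_le_sum_abs _ _).trans ((Finset.sum_le_card_nsmul _ _ _ hs).trans ?_)
  rw [nsmul_eq_mul, Nat.card_Icc, Nat.add_sub_cancel]
  have hk2 : (k : ℝ) ≤ 2 ^ k := by exact_mod_cast (Nat.lt_two_pow_self (n := k)).le
  calc (k : ℝ) * (2 ^ k * (D * T)) ≤ 2 ^ k * (2 ^ k * (D * T)) := by gcongr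
    _ = D * ((16 * Real.exp 2) ^ k / (k : ℝ) ^ ((k : ℝ) / 2)) := by
        rw [show (16 : ℝ) * Real.exp 2 = 2 * (2 * (4 * Real.exp 2)) by ring, mul_pow 2,
          mul_pow 2, hT]
        ring
end
end

section
/- There exists a set of positive real numbers C̄(k,m), k = 0, 1, 2, …, m = 0, 1, 2, …, with C̄(k,0) = 1, which can be written in the form C̄(k,m) = C̄(m)^k where C̄(m) is a monotone increasing sequence with C̄(0) = 1 and lim_{m→∞} C̄(m) < ∞, satisfying the inequalities C̄(k,m+1)^2 ≥ 2^{2l(4−m)} · (2k)^{2k−l+p} (2k−l−p)^{3l−p−2k} / (2l)^{2l} · C̄(2k−l−p, m) for all k = 0, 1, 2, …, m = 0, 1, 2, … and all integers 0 ≤ p ≤ l ≤ k, together with sup_{m ≥ 0} C̄(k,m) ≤ D(k) < ∞ for each k with some constants D(k) > 0. -/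
noncomputable section

open Real in
lemma div_pow_le_exp_sub {K : ℝ} (hK : 0 ≤ K) (n : ℕ) : (K / n) ^ n ≤ exp (K - n) := by
  rcases n.eq_zero_or_pos with rfl | hn
  · simpa using hK
  have hn' : (0 : ℝ) < n := by exact_mod_cast hn
  calc (K / n) ^ n ≤ exp (K / n - 1) ^ n := by
        gcongr
        linarith [add_one_le_exp (K / n - 1)]
    _ = exp (K - n) := by
        rw [← exp_nat_mul]
        congr 1
        field_simp

open Real in
lemma pow_mul_zpow_le_mul_exp_one_pow (p d j : ℕ) :
    ((2 * p + 2 * d + 2 * j : ℕ) : ℝ) ^ (2 * j + d + 2 * p) *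
        ((2 * j + d : ℕ) : ℝ) ^ (2 * (d : ℤ) - ((2 * j + d : ℕ) : ℤ)) ≤
      (((2 * p + 2 * d + 2 * j : ℕ) : ℝ) * exp 1) ^ (2 * p + 2 * d) := by
  set K : ℝ := ((2 * p + 2 * d + 2 * j : ℕ) : ℝ) with hKdef
  set n := 2 * j + d with hn
  have hK : 0 ≤ K := Nat.cast_nonneg _
  have hnK : (n : ℝ) ≤ K := by
    rw [hKdef]
    exact_mod_cast (by omega : n ≤ 2 * p + 2 * d + 2 * j)
  have hsplit : (n : ℝ) ^ (2 * (d : ℤ) - (n : ℤ)) = (n : ℝ) ^ (2 * d) / (n : ℝ) ^ n := by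
    rcases n.eq_zero_or_pos with h0 | h0
    · obtain rfl : d = 0 := by omega
      simp [h0]
    · rw [zpow_sub₀ (by exact_mod_cast h0.ne'), zpow_natCast]
      exact_mod_cast rfl
  have hexp : K - n ≤ (2 * p + 2 * d : ℕ) := by
    rw [hKdef, hn]
    push_cast
    linarith [(Nat.cast_nonneg d : (0 : ℝ) ≤ d)]
  calc K ^ (n + 2 * p) * (n : ℝ) ^ (2 * (d : ℤ) - (n : ℤ))
      = K ^ (2 * p) * (n : ℝ) ^ (2 * d) * (K / n) ^ n := by
        rw [hsplit, div_pow, pow_add]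
        ring
    _ ≤ K ^ (2 * p) * K ^ (2 * d) * exp (2 * p + 2 * d : ℕ) := by
        gcongr
        exact (div_pow_le_exp_sub hK n).trans (exp_le_exp.mpr hexp)
    _ = (K * exp 1) ^ (2 * p + 2 * d) := by
        rw [mul_pow, ← exp_nat_mul, pow_add, mul_one]

open Real in
lemma mul_exp_one_pow_div_le {t : ℝ} (ht : 0 ≤ t) (L : ℕ) :
    (t * exp 1) ^ L / (L : ℝ) ^ L ≤ exp t := by
  calc (t * exp 1) ^ L / (L : ℝ) ^ L = (t / L) ^ L * exp L := by
        rw [mul_pow, ← exp_nat_mul, mul_one, div_pow]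
        ring
    _ ≤ exp (t - L) * exp L := by
        gcongr
        exact div_pow_le_exp_sub ht L
    _ = exp t := by rw [← exp_add, sub_add_cancel]

/-- Lemma 5: there exist positive constants `C̄(k,m) = C̄(m)^k`, with `C̄` monotone
increasing, `C̄(0) = 1` and finite limit, satisfying the recursive inequalities (3.18) and
the uniform bounds (3.19). -/
theorem lemma5 :
    ∃ Cb : ℕ → ℝ,
      (∀ m, 0 < Cb m) ∧ Cb 0 = 1 ∧ Monotone Cb ∧
      (∃ L : ℝ, Filter.Tendsto Cb Filter.atTop (nhds L)) ∧
      (∀ k m l p : ℕ, p ≤ l → l ≤ k →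
        (2 : ℝ) ^ (2 * (l : ℝ) * (4 - (m : ℝ))) *
            ((2 * k : ℕ) : ℝ) ^ (2 * k - l + p) *
            (2 * (k : ℝ) - (l : ℝ) - (p : ℝ)) ^ (3 * (l : ℤ) - (p : ℤ) - 2 * (k : ℤ)) /
            ((2 * l : ℕ) : ℝ) ^ (2 * l) *
            Cb m ^ (2 * k - l - p)
          ≤ (Cb (m + 1) ^ k) ^ 2) ∧
      (∀ k : ℕ, ∃ D : ℝ, 0 < D ∧ ∀ m, Cb m ^ k ≤ D) := by
  have hanti : Antitone fun m : ℕ => ((1 : ℝ) / 2) ^ m :=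
    pow_right_anti₀ (by norm_num) (by norm_num)
  have hmono : Monotone fun m : ℕ => Real.exp (32 * (1 - (1 / 2) ^ m)) := fun a b hab => by
    have := hanti hab
    simp only [Real.exp_le_exp] at this ⊢
    linarith
  refine ⟨fun m => Real.exp (32 * (1 - (1 / 2) ^ m)), fun m => Real.exp_pos _, by simp, hmono,
    ⟨Real.exp (32 * (1 - 0)), ?_⟩, ?_, fun k => ⟨Real.exp 32 ^ k, by positivity, fun m => ?_⟩⟩
  · exact (Real.continuous_exp.tendsto _).comp (((tendsto_pow_atTop_nhds_zero_of_lt_one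
      (by norm_num) (by norm_num)).const_sub 1).const_mul 32)
  · intro k m l p hpl hlk
    obtain ⟨d, rfl⟩ := Nat.exists_eq_add_of_le hpl
    obtain ⟨j, rfl⟩ := Nat.exists_eq_add_of_le hlk
    set x : ℝ := (2 : ℝ) ^ (4 - (m : ℝ)) with hx
    have hx0 : 0 ≤ x := by positivity
    have hx' : x = 16 * (1 / 2) ^ m := by
      rw [hx, Real.rpow_sub two_pos, Real.rpow_natCast, one_div, inv_pow, ← div_eq_mul_inv]
      norm_num
    have hpow : (2 : ℝ) ^ (2 * ((p + d : ℕ) : ℝ) * (4 - (m : ℝ))) = x ^ (2 * p + 2 * d) := by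
      rw [hx, ← Real.rpow_natCast, ← Real.rpow_mul two_pos.le]
      congr 1
      push_cast
      ring
    have hbase : 2 * ((p + d + j : ℕ) : ℝ) - ((p + d : ℕ) : ℝ) - (p : ℝ)
        = ((2 * j + d : ℕ) : ℝ) := by
      push_cast
      ring
    have hexp : 3 * ((p + d : ℕ) : ℤ) - (p : ℤ) - 2 * ((p + d + j : ℕ) : ℤ)
        = 2 * (d : ℤ) - ((2 * j + d : ℕ) : ℤ) := by
      push_cast
      ring
    rw [hpow, hbase, hexp, show 2 * (p + d + j) - (p + d) + p = 2 * j + d + 2 * p by omega,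
      show 2 * (p + d + j) - (p + d) - p = 2 * j + d by omega,
      show 2 * (p + d + j) = 2 * p + 2 * d + 2 * j by ring,
      show 2 * (p + d) = 2 * p + 2 * d by ring, ← pow_mul,
      show (p + d + j) * 2 = 2 * p + 2 * d + 2 * j by ring]
    set K := 2 * p + 2 * d + 2 * j with hK
    set L := 2 * p + 2 * d with hL
    have hcoeff : x ^ L * (K : ℝ) ^ (2 * j + d + 2 * p) *
        ((2 * j + d : ℕ) : ℝ) ^ (2 * (d : ℤ) - ((2 * j + d : ℕ) : ℤ)) / (L : ℝ) ^ L
        ≤ Real.exp (x * K) :=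
      calc _ ≤ x ^ L * ((K : ℝ) * Real.exp 1) ^ L / (L : ℝ) ^ L := by
            rw [mul_assoc]
            gcongr
            exact pow_mul_zpow_le_mul_exp_one_pow p d j
        _ = (x * K * Real.exp 1) ^ L / (L : ℝ) ^ L := by rw [← mul_pow, mul_assoc]
        _ ≤ Real.exp (x * K) := mul_exp_one_pow_div_le (by positivity) L
    have hone : 1 ≤ Real.exp (32 * (1 - (1 / 2) ^ m)) := by
      simpa using hmono (Nat.zero_le m)
    calc _ ≤ Real.exp (x * K) * Real.exp (32 * (1 - (1 / 2) ^ m)) ^ K := by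
          gcongr
          omega
      _ = Real.exp (32 * (1 - (1 / 2) ^ (m + 1))) ^ K := by
          rw [← Real.exp_nat_mul, ← Real.exp_nat_mul, ← Real.exp_add, hx', pow_succ]
          congr 1
          ring
  · gcongr
    rw [Real.exp_le_exp]
    linarith [pow_nonneg (by norm_num : (0 : ℝ) ≤ 1 / 2) m]
end
end

section
/- Let f be a function on (X^{k_1}, 𝒳^{k_1}, μ^{k_1}) and g a function on (X^{k_2}, 𝒳^{k_2}, μ^{k_2}) with ‖f‖_∞ ≤ 1 and ‖g‖_∞ ≤ 1. Then for every coloured diagram B(𝒩,𝒩₁) one has ‖ f∘g_{B(𝒩,𝒩₁)} ‖_2^2 ≤ ‖f‖_2 · ‖g‖_2. -/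
open MeasureTheory
open scoped ENNReal Classical

noncomputable section

namespace EmpInt

variable {X : Type*} [MeasurableSpace X] [Nonempty X]

/-- The substitution operators `R_{j,j'}`: for every edge `(a s, b s)` the variable with
index `b s` (in the second row) is replaced by the variable with index `a s` (first row). -/
def subFun {k₁ k₂ l : ℕ} (a : Fin l → Fin k₁) (b : Fin l → Fin k₂)
    (x : Fin k₁ → X) (y : Fin k₂ → X) : Fin k₂ → X :=
  fun j => if h : ∃ s, b s = j then x (a (Classical.choose h)) else y j

/-- The function `\overline{f∘g}_{B(𝒩,𝒩₁)}`: apply the substitutions `R_{a s, b s}` for all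
edges `s`, then integrate out (operators `P_{a s}`) the first-row variables of the coloured
edges `s ∈ c`; a function of the remaining variables. -/
def diagAux (μ : Measure X) {k₁ k₂ l : ℕ} (f : (Fin k₁ → X) → ℝ) (g : (Fin k₂ → X) → ℝ)
    (a : Fin l → Fin k₁) (b : Fin l → Fin k₂) (c : Finset (Fin l))
    (xr : {i : Fin k₁ // i ∉ c.image a} → X)
    (yr : {j : Fin k₂ // j ∉ Finset.image b Finset.univ} → X) : ℝ :=
  ∫ w : Fin k₁ → X,
    (fun x : Fin k₁ → X =>
        f x * g (subFun a b x fun j =>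
          if h : j ∉ Finset.image b Finset.univ then yr ⟨j, h⟩ else Classical.arbitrary X))
      (fun i => if h : i ∉ c.image a then xr ⟨i, h⟩ else w i)
    ∂(Measure.pi fun _ : Fin k₁ => μ)

/-- The rank of `i` in the finset `T`, i.e. the number of elements of `T` smaller than `i`;
used to relabel the remaining variables in increasing order of their original indices. -/
def rankIn {m : ℕ} (T : Finset (Fin m)) (i : Fin m) : ℕ := (T.filter (· < i)).card

/-- The set of indices (inside `{1,…,k₁+k₂}`) of the variables remaining after applying the
operators prescribed by the coloured diagram. -/
def remainingSet (k₁ k₂ l : ℕ) (a : Fin l → Fin k₁) (b : Fin l → Fin k₂)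
    (c : Finset (Fin l)) : Finset (Fin (k₁ + k₂)) :=
  ((Finset.univ.filter fun i : Fin k₁ => i ∉ c.image a).image (Fin.castAdd k₂)) ∪
    ((Finset.univ.filter fun j : Fin k₂ => j ∉ Finset.image b Finset.univ).image
      (Fin.natAdd k₁))

/-- The function `f∘g_{B(𝒩,𝒩₁)}` of the coloured diagram with edges `(a s, b s)`,
`s = 1,…,l`, coloured subset `c`, with the remaining variables relabelled as
`x_1, x_2, …` in increasing order of their original indices. -/
def diagFun (μ : Measure X) {k₁ k₂ l : ℕ} (f : (Fin k₁ → X) → ℝ) (g : (Fin k₂ → X) → ℝ)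
    (a : Fin l → Fin k₁) (b : Fin l → Fin k₂) (c : Finset (Fin l)) (m : ℕ) :
    (Fin m → X) → ℝ := fun z =>
  diagAux μ f g a b c
    (fun i =>
      if h : rankIn (remainingSet k₁ k₂ l a b c) (Fin.castAdd k₂ i.1) < m then z ⟨_, h⟩
      else Classical.arbitrary X)
    (fun j =>
      if h : rankIn (remainingSet k₁ k₂ l a b c) (Fin.natAdd k₁ j.1) < m then z ⟨_, h⟩
      else Classical.arbitrary X)

end EmpInt

/-- Reindexing an i.i.d. family along an injective map gives an i.i.d. family. -/
theorem measurePreserving_comp_injective {X ι κ : Type*} [MeasurableSpace X] [Fintype ι]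
    [Fintype κ] (μ : Measure X) [IsProbabilityMeasure μ] {φ : ι → κ}
    (hφ : Function.Injective φ) :
    MeasurePreserving (fun (z : κ → X) i => z (φ i))
      (Measure.pi fun _ => μ) (Measure.pi fun _ => μ) := by
  have hm : Measurable (fun (z : κ → X) i => z (φ i)) := by fun_prop
  refine ⟨hm, (Measure.pi_eq fun s hs => ?_).symm⟩
  rw [Measure.map_apply hm (MeasurableSet.univ_pi hs)]
  have hpre : (fun (z : κ → X) i => z (φ i)) ⁻¹' Set.univ.pi s =
      Set.univ.pi (Function.extend φ s fun _ => Set.univ) := by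
    ext z
    simp only [Set.mem_preimage, Set.mem_univ_pi]
    constructor
    · intro h k
      by_cases hk : ∃ i, φ i = k
      · obtain ⟨i, rfl⟩ := hk
        simpa [hφ.extend_apply] using h i
      · simp [Function.extend_apply' _ _ _ hk]
    · intro h i
      simpa [hφ.extend_apply] using h (φ i)
  rw [hpre, Measure.pi_pi,
    ← Finset.prod_subset (Finset.subset_univ (Finset.univ.image φ)),
    Finset.prod_image hφ.injOn]
  · simp [hφ.extend_apply]
  · intro k _ hk
    rw [Function.extend_apply' _ _ _ (by simpa using hk), measure_univ]

theorem measurePreserving_sumElim_comp_injective {X ι α β : Type*} [MeasurableSpace X]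
    [Fintype ι] [Fintype α] [Fintype β] (μ : Measure X) [IsProbabilityMeasure μ]
    {φ : ι → α ⊕ β} (hφ : Function.Injective φ) :
    MeasurePreserving (fun (p : (α → X) × (β → X)) i => (Sum.elim p.1 p.2 : α ⊕ β → X) (φ i))
      ((Measure.pi fun _ => μ).prod (Measure.pi fun _ => μ)) (Measure.pi fun _ => μ) := by
  convert (measurePreserving_comp_injective μ hφ).comp
    (measurePreserving_sumPiEquivProdPi_symm fun _ : α ⊕ β => μ) using 1
  ext p i
  rcases h : φ i with j | j <;>
    simp [h, MeasurableEquiv.coe_sumPiEquivProdPi_symm, Equiv.sumPiEquivProdPi]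

theorem integral_abs_mul_abs_le_sqrt_mul_sqrt {Ω : Type*} [MeasurableSpace Ω]
    {P : Measure Ω} {u v : Ω → ℝ} (hu : MemLp u 2 P) (hv : MemLp v 2 P) :
    ∫ ω, |u ω| * |v ω| ∂P ≤ √(∫ ω, u ω ^ 2 ∂P) * √(∫ ω, v ω ^ 2 ∂P) := by
  have h := integral_mul_le_Lp_mul_Lq_of_nonneg (μ := P) Real.HolderConjugate.two_two
    (f := fun ω => |u ω|) (g := fun ω => |v ω|)
    (Filter.Eventually.of_forall fun ω => abs_nonneg _)
    (Filter.Eventually.of_forall fun ω => abs_nonneg _)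
    (by simpa using! hu.abs) (by simpa using! hv.abs)
  simpa [Real.sqrt_eq_rpow] using h

theorem memLp_of_abs_le_one {Ω : Type*} [MeasurableSpace Ω] {P : Measure Ω}
    [IsFiniteMeasure P] {u : Ω → ℝ} (hu : Measurable u) (h : ∀ ω, |u ω| ≤ 1) (p : ℝ≥0∞) :
    MemLp u p P :=
  MemLp.of_bound hu.aestronglyMeasurable 1 (Filter.Eventually.of_forall h)

theorem integral_sq_integral_le_integral_prod_abs {Ω₁ Ω₂ : Type*} [MeasurableSpace Ω₁]
    [MeasurableSpace Ω₂] (P : Measure Ω₁) (Q : Measure Ω₂) [IsProbabilityMeasure P]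
    [IsProbabilityMeasure Q] {h : Ω₁ × Ω₂ → ℝ} (hm : Measurable h) (h1 : ∀ p, |h p| ≤ 1) :
    ∫ z, (∫ w, h (z, w) ∂Q) ^ 2 ∂P ≤ ∫ p, |h p| ∂(P.prod Q) := by
  have hint : Integrable (fun p => |h p|) (P.prod Q) :=
    (memLp_one_iff_integrable.1 (memLp_of_abs_le_one hm h1 1)).abs
  rw [integral_prod _ hint]
  refine integral_mono_of_nonneg (Filter.Eventually.of_forall fun z => sq_nonneg _)
    hint.integral_prod_left (Filter.Eventually.of_forall fun z => ?_)
  have hb : |∫ w, h (z, w) ∂Q| ≤ 1 := by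
    simpa using norm_integral_le_of_norm_le_const (μ := Q)
      (f := fun w => h (z, w))
      (Filter.Eventually.of_forall fun w => (h1 (z, w) : ‖h (z, w)‖ ≤ 1))
  calc (∫ w, h (z, w) ∂Q) ^ 2 = |∫ w, h (z, w) ∂Q| * |∫ w, h (z, w) ∂Q| := by
        rw [← sq, sq_abs]
    _ ≤ |∫ w, h (z, w) ∂Q| * 1 := by gcongr
    _ ≤ ∫ w, |h (z, w)| ∂Q := by
        rw [mul_one]
        exact abs_integral_le_integral_abs

theorem integral_sq_integral_mul_le {X ι₁ ι₂ α β : Type*} [MeasurableSpace X]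
    [Fintype ι₁] [Fintype ι₂] [Fintype α] [Fintype β] (μ : Measure X) [IsProbabilityMeasure μ]
    {φ : ι₁ → α ⊕ β} {ψ : ι₂ → α ⊕ β} (hφ : Function.Injective φ) (hψ : Function.Injective ψ)
    {f : (ι₁ → X) → ℝ} {g : (ι₂ → X) → ℝ} (hf : Measurable f) (hg : Measurable g)
    (hf1 : ∀ x, |f x| ≤ 1) (hg1 : ∀ y, |g y| ≤ 1) :
    ∫ z, (∫ w, f (fun i => (Sum.elim z w : α ⊕ β → X) (φ i)) *
        g (fun j => (Sum.elim z w : α ⊕ β → X) (ψ j)) ∂(Measure.pi fun _ : β => μ)) ^ 2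
        ∂(Measure.pi fun _ : α => μ) ≤
      √(∫ x, f x ^ 2 ∂(Measure.pi fun _ => μ)) * √(∫ y, g y ^ 2 ∂(Measure.pi fun _ => μ)) := by
  have hx := measurePreserving_sumElim_comp_injective μ hφ
  have hy := measurePreserving_sumElim_comp_injective μ hψ
  have hu := hf.comp hx.measurable
  have hv := hg.comp hy.measurable
  refine (integral_sq_integral_le_integral_prod_abs (Measure.pi fun _ : α => μ)
    (Measure.pi fun _ : β => μ) (hu.mul hv) fun p => ?_).trans ?_
  · simp only [Pi.mul_apply, abs_mul]
    exact mul_le_one₀ (hf1 _) (abs_nonneg _) (hg1 _)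
  · simp only [Pi.mul_apply, abs_mul]
    refine (integral_abs_mul_abs_le_sqrt_mul_sqrt
      (memLp_of_abs_le_one hu (fun _ => hf1 _) 2)
      (memLp_of_abs_le_one hv (fun _ => hg1 _) 2)).trans_eq ?_
    rw [← hx.map_eq, ← hy.map_eq,
      integral_map hx.aemeasurable (hf.pow_const 2).aestronglyMeasurable,
      integral_map hy.aemeasurable (hg.pow_const 2).aestronglyMeasurable]
    rfl

namespace EmpInt

theorem rankIn_lt_card {m : ℕ} {T : Finset (Fin m)} {i : Fin m} (hi : i ∈ T) :
    rankIn T i < T.card :=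
  Finset.card_lt_card (Finset.filter_ssubset.2 ⟨i, hi, lt_irrefl i⟩)

theorem rankIn_lt_rankIn {m : ℕ} {T : Finset (Fin m)} {i j : Fin m} (hi : i ∈ T)
    (hij : i < j) : rankIn T i < rankIn T j := by
  refine Finset.card_lt_card (Finset.ssubset_iff_of_subset ?_ |>.2 ⟨i, ?_, ?_⟩)
  · intro k hk
    simp only [Finset.mem_filter] at hk ⊢
    exact ⟨hk.1, hk.2.trans hij⟩
  · simp [hi, hij]
  · simp

theorem rankIn_injOn {m : ℕ} (T : Finset (Fin m)) : Set.InjOn (rankIn T) T := by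
  intro i hi j hj h
  rcases lt_trichotomy i j with hij | hij | hij
  · exact absurd h (rankIn_lt_rankIn hi hij).ne
  · exact hij
  · exact absurd h (rankIn_lt_rankIn hj hij).ne'

theorem castAdd_mem_remainingSet {k₁ k₂ l : ℕ} {a : Fin l → Fin k₁} {b : Fin l → Fin k₂}
    {c : Finset (Fin l)} {i : Fin k₁} (hi : i ∉ c.image a) :
    Fin.castAdd k₂ i ∈ remainingSet k₁ k₂ l a b c :=
  Finset.mem_union_left _ (Finset.mem_image_of_mem _
    (Finset.mem_filter.2 ⟨Finset.mem_univ _, hi⟩))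

theorem natAdd_mem_remainingSet {k₁ k₂ l : ℕ} {a : Fin l → Fin k₁} {b : Fin l → Fin k₂}
    {c : Finset (Fin l)} {j : Fin k₂} (hj : j ∉ Finset.image b Finset.univ) :
    Fin.natAdd k₁ j ∈ remainingSet k₁ k₂ l a b c :=
  Finset.mem_union_right _ (Finset.mem_image_of_mem _
    (Finset.mem_filter.2 ⟨Finset.mem_univ _, hj⟩))

theorem castAdd_ne_natAdd {k₁ k₂ : ℕ} (i : Fin k₁) (j : Fin k₂) :
    Fin.castAdd k₂ i ≠ Fin.natAdd k₁ j := by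
  intro h
  have := congrArg Fin.val h
  simp only [Fin.val_castAdd, Fin.val_natAdd] at this
  omega

theorem card_remainingSet {k₁ k₂ l : ℕ} {a : Fin l → Fin k₁} {b : Fin l → Fin k₂}
    (ha : Function.Injective a) (hb : Function.Injective b) (c : Finset (Fin l)) :
    (remainingSet k₁ k₂ l a b c).card = k₁ + k₂ - l - c.card := by
  have h₁ : (Finset.univ.filter fun i : Fin k₁ => i ∉ c.image a).card = k₁ - c.card := by
    rw [Finset.filter_notMem_eq_sdiff, ← Finset.compl_eq_univ_sdiff, Finset.card_compl,
      Finset.card_image_of_injective _ ha, Fintype.card_fin]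
  have h₂ : (Finset.univ.filter fun j : Fin k₂ => j ∉ Finset.image b Finset.univ).card =
      k₂ - l := by
    rw [Finset.filter_notMem_eq_sdiff, ← Finset.compl_eq_univ_sdiff, Finset.card_compl,
      Finset.card_image_of_injective _ hb, Fintype.card_fin, Finset.card_fin]
  have hl₁ : l ≤ k₁ := by simpa using Fintype.card_le_of_injective a ha
  have hl₂ : l ≤ k₂ := by simpa using Fintype.card_le_of_injective b hb
  have hc : c.card ≤ l := by simpa using c.card_le_univ
  rw [remainingSet, Finset.card_union_of_disjoint,
    Finset.card_image_of_injective _ (Fin.castAdd_injective k₁ k₂),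
    Finset.card_image_of_injective _ (Fin.natAdd_injective k₂ k₁), h₁, h₂]
  · omega
  · simp only [Finset.disjoint_left, Finset.mem_image]
    rintro _ ⟨i, -, rfl⟩ ⟨j, -, h⟩
    exact castAdd_ne_natAdd i j h.symm

section Slots

variable {k₁ k₂ l m : ℕ} {a : Fin l → Fin k₁} {b : Fin l → Fin k₂} {c : Finset (Fin l)}

/-- The slot holding the `i`-th argument of `f`: a remaining variable or one that is
integrated out. -/
def slotFst (b : Fin l → Fin k₂) (hm : (remainingSet k₁ k₂ l a b c).card = m) (i : Fin k₁) :
    Fin m ⊕ Fin k₁ :=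
  if h : i ∉ c.image a then
    Sum.inl ⟨_, (rankIn_lt_card (castAdd_mem_remainingSet h)).trans_eq hm⟩
  else Sum.inr i

/-- The slot holding the `j`-th argument of `g`: that of the other end of the edge at `j` if
there is one, a remaining variable otherwise. -/
def slotSnd (hm : (remainingSet k₁ k₂ l a b c).card = m) (j : Fin k₂) : Fin m ⊕ Fin k₁ :=
  if h : ∃ s, b s = j then slotFst b hm (a (Classical.choose h))
  else Sum.inl ⟨_, (rankIn_lt_card (natAdd_mem_remainingSet (by simpa using h))).trans_eq hm⟩

theorem slotFst_injective (hm : (remainingSet k₁ k₂ l a b c).card = m) :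
    Function.Injective (slotFst (a := a) b hm) := by
  intro i i' h
  unfold slotFst at h
  split_ifs at h with hi hi' hi'
  · exact Sum.inr_injective h
  · simp only [Sum.inl.injEq, Fin.mk.injEq] at h
    exact Fin.castAdd_injective k₁ k₂ (rankIn_injOn _ (castAdd_mem_remainingSet hi)
      (castAdd_mem_remainingSet hi') h)

theorem slotFst_ne_inl_natAdd (hm : (remainingSet k₁ k₂ l a b c).card = m) (i : Fin k₁)
    {j : Fin k₂} (hj : j ∉ Finset.image b Finset.univ)
    (h : rankIn (remainingSet k₁ k₂ l a b c) (Fin.natAdd k₁ j) < m) :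
    slotFst b hm i ≠ Sum.inl ⟨_, h⟩ := by
  intro he
  unfold slotFst at he
  split_ifs at he with hi
  simp only [Sum.inl.injEq, Fin.mk.injEq] at he
  exact castAdd_ne_natAdd i j (rankIn_injOn _ (castAdd_mem_remainingSet hi)
    (natAdd_mem_remainingSet hj) he)

theorem slotSnd_injective (ha : Function.Injective a)
    (hm : (remainingSet k₁ k₂ l a b c).card = m) :
    Function.Injective (slotSnd (a := a) (b := b) hm) := by
  intro j j' h
  unfold slotSnd at h
  split_ifs at h with hj hj' hj'
  · rw [← Classical.choose_spec hj, ha (slotFst_injective hm h), Classical.choose_spec hj']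
  · exact absurd h (slotFst_ne_inl_natAdd hm _ (by simpa using hj') _)
  · exact absurd h.symm (slotFst_ne_inl_natAdd hm _ (by simpa using hj) _)
  · simp only [Sum.inl.injEq, Fin.mk.injEq] at h
    exact Fin.natAdd_injective k₂ k₁ (rankIn_injOn _
      (natAdd_mem_remainingSet (by simpa using hj))
      (natAdd_mem_remainingSet (by simpa using hj')) h)

theorem diagFun_eq_integral {X : Type*} [MeasurableSpace X] [Nonempty X] (μ : Measure X)
    (f : (Fin k₁ → X) → ℝ) (g : (Fin k₂ → X) → ℝ)
    (hm : (remainingSet k₁ k₂ l a b c).card = m) (z : Fin m → X) :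
    diagFun μ f g a b c m z =
      ∫ w, f (fun i => (Sum.elim z w : Fin m ⊕ Fin k₁ → X) (slotFst b hm i)) *
        g (fun j => (Sum.elim z w : Fin m ⊕ Fin k₁ → X) (slotSnd hm j))
        ∂(Measure.pi fun _ : Fin k₁ => μ) := by
  unfold diagFun diagAux
  refine integral_congr_ae (Filter.Eventually.of_forall fun w => ?_)
  have hx : ∀ i, (if h : i ∉ c.image a then
      (if h' : rankIn (remainingSet k₁ k₂ l a b c) (Fin.castAdd k₂ i) < m then z ⟨_, h'⟩
        else Classical.arbitrary X) else w i) =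
      (Sum.elim z w : Fin m ⊕ Fin k₁ → X) (slotFst b hm i) := by
    intro i
    unfold slotFst
    by_cases hi : i ∉ c.image a
    · rw [dif_pos hi, dif_pos hi,
        dif_pos ((rankIn_lt_card (castAdd_mem_remainingSet hi)).trans_eq hm), Sum.elim_inl]
    · rw [dif_neg hi, dif_neg hi, Sum.elim_inr]
  simp only [hx]
  congr 2
  funext j
  unfold subFun slotSnd
  by_cases hj : ∃ s, b s = j
  · rw [dif_pos hj, dif_pos hj]
  · have hj' : j ∉ Finset.image b Finset.univ := by simpa using hj
    rw [dif_neg hj, dif_neg hj]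
    beta_reduce
    rw [dif_pos hj',
      dif_pos ((rankIn_lt_card (natAdd_mem_remainingSet hj')).trans_eq hm), Sum.elim_inl]

end Slots

end EmpInt

/-- Formula (3.14): for bounded `f` and `g`,
`‖f∘g_{B(𝒩,𝒩₁)}‖_2^2 ≤ ‖f‖_2·‖g‖_2` for any coloured diagram `B(𝒩,𝒩₁)`. -/
theorem kernel_L2_bound
    (X : Type) [MeasurableSpace X] [Nonempty X] (μ : Measure X) [IsProbabilityMeasure μ]
    (k₁ k₂ l : ℕ) (hk₁ : 1 ≤ k₁) (hk₂ : 1 ≤ k₂)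
    (a : Fin l → Fin k₁) (b : Fin l → Fin k₂)
    (ha : Function.Injective a) (hb : Function.Injective b) (c : Finset (Fin l))
    (f : (Fin k₁ → X) → ℝ) (g : (Fin k₂ → X) → ℝ)
    (hf : Measurable f) (hg : Measurable g)
    (hf1 : ∀ x, |f x| ≤ 1) (hg1 : ∀ y, |g y| ≤ 1) :
    ∫ z, (EmpInt.diagFun μ f g a b c (k₁ + k₂ - l - c.card) z) ^ 2
        ∂(Measure.pi fun _ : Fin (k₁ + k₂ - l - c.card) => μ) ≤
      Real.sqrt (∫ x, f x ^ 2 ∂(Measure.pi fun _ : Fin k₁ => μ)) *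
        Real.sqrt (∫ y, g y ^ 2 ∂(Measure.pi fun _ : Fin k₂ => μ)) := by
  have hm := EmpInt.card_remainingSet ha hb c
  simp only [EmpInt.diagFun_eq_integral μ f g hm]
  exact integral_sq_integral_mul_le μ (EmpInt.slotFst_injective hm)
    (EmpInt.slotSnd_injective ha hm) hf hg hf1 hg1
end
end
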